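/- For every integer $n \geq 1$, if a family of closed sets $(A^i_1,\dots,A^i_n \mid i \in [n])$ is an $n$-weakly KKM cover of $\Delta^{n-1}$ in the sense that for every single index $j \in [n]$ the family $(A^j_1,\dots,A^j_n)$ is a KKM cover of $\Delta^{n-1}$, then there exists a permutation $\pi$ of $[n]$ with $\bigcap_{i=1}^n A^{\pi(i)}_i \neq \emptyset$. -/

import Mathlib

open Set

/-- `B` is a KKM cover of the standard simplex `Δ^{n-1}`. -/
def IsKKMCover {n : ℕ} (B : Fin n → Set (Fin n → ℝ)) : Prop :=
  ∀ S : Finset (Fin n), S.Nonempty →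
    ∀ x ∈ stdSimplex ℝ (Fin n), (∀ j, j ∉ S → x j = 0) → ∃ j ∈ S, x ∈ B j

namespace KKMaux

/-- vertices of the Kuhn simplex -/
def V {d : ℕ} (y : Fin d → ℤ) (τ : Equiv.Perm (Fin d)) (k : Fin (d+1)) : Fin d → ℤ :=
  fun j => y j + if (τ j : ℕ) < (k : ℕ) then 1 else 0

/-- extended partial sums -/
def Y {d : ℕ} (N : ℤ) (y : Fin d → ℤ) : ℕ → ℤ
  | 0 => 0
  | i+1 => if h : i < d then y ⟨i, h⟩ else N

/-- barycentric coordinates -/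
def X {d : ℕ} (N : ℤ) (y : Fin d → ℤ) (i : Fin (d+1)) : ℤ := Y N y (i+1) - Y N y i

lemma Y_V {d : ℕ} (N : ℤ) (y : Fin d → ℤ) (τ : Equiv.Perm (Fin d)) :
    ∃ T : ℕ → ℕ, ∀ (k : Fin (d+1)) i, Y N (V y τ k) i = Y N y i + if T i < (k:ℕ) then 1 else 0 := by
  refine ⟨fun i => match i with
    | 0 => d+1
    | i+1 => if h : i < d then (τ ⟨i,h⟩ : ℕ) else d+1, ?_⟩
  intro k i
  have := k.2
  cases i with
  | zero =>
    simp [Y]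
    try omega
  | succ i =>
    by_cases h : i < d
    · simp [Y, V, h]
    · simp [Y, h]
      try omega

lemma X_sign {d : ℕ} (N : ℤ) (y : Fin d → ℤ) (τ : Equiv.Perm (Fin d)) (k m : Fin (d+1))
    (i : Fin (d+1)) (h : 0 < X N (V y τ m) i) : 0 ≤ X N (V y τ k) i := by
  obtain ⟨T, hT⟩ := Y_V N y τ
  simp only [X, hT] at *
  split_ifs at * <;> omega

lemma X_close {d : ℕ} (N : ℤ) (y : Fin d → ℤ) (τ : Equiv.Perm (Fin d)) (k m : Fin (d+1))
    (i : Fin (d+1)) : |X N (V y τ m) i - X N (V y τ k) i| ≤ 1 := by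
  obtain ⟨T, hT⟩ := Y_V N y τ
  simp only [X, hT] at *
  rw [abs_le]
  split_ifs at * <;> omega

lemma X_sum {d : ℕ} (N : ℤ) (y : Fin d → ℤ) : ∑ i, X N y i = N := by
  have := Fin.sum_univ_eq_sum_range (fun i => Y N y (i+1) - Y N y i) (d+1)
  simp only [X]
  rw [this, Finset.sum_range_sub]
  simp [Y]

lemma door_count (n : ℕ) (f : Fin (n+1) → Fin (n+1)) :
    (∑ m : Fin (n+1), (open Classical in if ∀ a, a ≠ 0 → ∃ k, k ≠ m ∧ f k = a then (1 : ZMod 2) else 0))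
      = open Classical in if Function.Surjective f then 1 else 0 := by
  classical
  by_cases hs : Function.Surjective f
  · have hb : Function.Injective f := Finite.injective_iff_surjective.2 hs
    obtain ⟨m0, hm0⟩ := hs 0
    rw [Finset.sum_eq_single m0]
    · rw [if_pos, if_pos hs]
      intro a ha
      obtain ⟨k, rfl⟩ := hs a
      exact ⟨k, by rintro rfl; exact ha hm0, rfl⟩
    · intro m _ hm
      rw [if_neg]
      intro h
      by_cases h0 : f m = 0
      · exact hm (hb (h0.trans hm0.symm))
      · obtain ⟨k, hk, hk'⟩ := h _ h0
        exact hk (hb hk')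
    · simp
  · rw [if_neg hs]
    by_cases hd : ∃ m, ∀ a, a ≠ 0 → ∃ k, k ≠ m ∧ f k = a
    · obtain ⟨m0, h0⟩ := hd
      have inj : ∀ m, (∀ a, a ≠ 0 → ∃ k, k ≠ m ∧ f k = a) → ∀ k l, k ≠ m → l ≠ m → f k = f l → k = l := by
        intro m hm k l hk hl hkl
        have : Set.InjOn f ((Finset.univ.erase m : Finset (Fin (n+1))) : Set (Fin (n+1))) := by
          have hsub : (Finset.univ.erase (0 : Fin (n+1))) ⊆ (Finset.univ.erase m).image f := by
            intro a ha
            obtain ⟨k, hk, hk'⟩ := hm a (by simpa using ha)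
            exact Finset.mem_image.2 ⟨k, by simpa using hk, hk'⟩
          have := Finset.card_le_card hsub
          apply Finset.injOn_of_card_image_eq
          apply le_antisymm Finset.card_image_le
          simpa using this
        exact this (by simpa using hk) (by simpa using hl) hkl
      have hf0 : f m0 ≠ 0 := by
        intro hf
        apply hs
        intro a
        by_cases ha : a = 0
        · exact ⟨m0, by rw [hf, ha]⟩
        · obtain ⟨k, -, hk⟩ := h0 a ha
          exact ⟨k, hk⟩
      obtain ⟨k0, hk0, hfk⟩ := h0 _ hf0
      have hk : ∀ a, a ≠ 0 → ∃ k, k ≠ k0 ∧ f k = a := by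
        intro a ha
        obtain ⟨k, hk, hka⟩ := h0 a ha
        by_cases h : k = k0
        · exact ⟨m0, hk0.symm, by rw [← hfk, ← h, hka]⟩
        · exact ⟨k, h, hka⟩
      rw [← Finset.sum_subset (Finset.subset_univ {m0, k0})]
      · rw [Finset.sum_pair hk0.symm, if_pos h0, if_pos hk]
        decide
      · intro m _ hm
        simp only [Finset.mem_insert, Finset.mem_singleton, not_or] at hm
        rw [if_neg]
        intro h
        exact hk0 (inj m h k0 m0 (Ne.symm hm.2) (Ne.symm hm.1) hfk)
    · apply Finset.sum_eq_zero
      intro m _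
      rw [if_neg]
      exact fun h => hd ⟨m, h⟩

/-- simplices -/
abbrev S (e : ℕ) := (Fin (e+1) → ℤ) × Equiv.Perm (Fin (e+1))

/-- The facet-preserving involution. -/
def rho {e : ℕ} (p : S e × Fin (e+2)) : S e × Fin (e+2) :=
  if p.2 = 0 then
    ((fun j => p.1.1 j + if p.1.2 j = 0 then 1 else 0, p.1.2.trans (finRotate (e+1)).symm), Fin.last _)
  else if p.2 = Fin.last _ then
    ((fun j => p.1.1 j - if p.1.2 j = Fin.last _ then 1 else 0, p.1.2.trans (finRotate (e+1))), 0)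
  else ((p.1.1, p.1.2.trans (Equiv.swap (Fin.ofNat _ (p.2 - 1 : ℕ)) (Fin.ofNat _ (p.2 : ℕ)))), p.2)

lemma rho_rho {e : ℕ} (p : S e × Fin (e+2)) : rho (rho p) = p := by
  obtain ⟨⟨y, τ⟩, m⟩ := p
  by_cases h0 : m = 0
  · subst h0
    have : (Fin.last (e+1)) ≠ 0 := by simp
    have h2 : ∀ i : Fin (e+1), (finRotate (e+1)).symm i = Fin.last e ↔ i = 0 := by
      intro i
      rw [Equiv.symm_apply_eq, finRotate_last]
    simp only [rho, if_true, if_neg this, Equiv.trans_apply, h2]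
    refine Prod.ext (Prod.ext ?_ ?_) rfl
    · funext j; simp
    · ext j; simp
  · by_cases h1 : m = Fin.last _
    · subst h1
      have h2 : ∀ i : Fin (e+1), (finRotate (e+1)) i = 0 ↔ i = Fin.last e := by
        intro i
        rw [← finRotate_last, (finRotate (e+1)).injective.eq_iff]
      simp only [rho, if_true, if_neg h0, Equiv.trans_apply, h2]
      refine Prod.ext (Prod.ext ?_ ?_) rfl
      · funext j; simp
      · ext j; simp
    · simp only [rho, if_neg h0, if_neg h1]
      refine Prod.ext (Prod.ext rfl ?_) rfl
      ext j; simp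

lemma rho_ne {e : ℕ} (p : S e × Fin (e+2)) : rho p ≠ p := by
  obtain ⟨⟨y, τ⟩, m⟩ := p
  intro h
  by_cases h0 : m = 0
  · subst h0
    have := congrArg Prod.snd h
    simp [rho] at this
  · by_cases h1 : m = Fin.last _
    · subst h1
      have := congrArg Prod.snd h
      simp [rho] at this
    · simp only [rho, if_neg h0, if_neg h1] at h
      have h3 := congrArg (fun q => q.1.2 (τ.symm (Fin.ofNat _ (m : ℕ)))) h
      simp only [Equiv.trans_apply, Equiv.apply_symm_apply, Equiv.swap_apply_right] at h3
      have h4 := congrArg Fin.val h3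
      have : (m : ℕ) ≠ 0 := fun h => h0 (Fin.ext h)
      have : (m : ℕ) ≠ e+1 := fun h => h1 (Fin.ext h)
      have := m.2
      simp only [Fin.ofNat] at h4
      rw [Nat.mod_eq_of_lt (by omega), Nat.mod_eq_of_lt (by omega)] at h4
      omega

lemma rho_facet {e : ℕ} (p : S e × Fin (e+2)) (k : Fin (e+2)) (hk : k ≠ p.2) :
    ∃ k', k' ≠ (rho p).2 ∧ V (rho p).1.1 (rho p).1.2 k' = V p.1.1 p.1.2 k := by
  obtain ⟨⟨y, τ⟩, m⟩ := p
  simp only at hk ⊢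
  have hklt := k.2
  by_cases h0 : m = 0
  · subst h0
    have hk0 : (k : ℕ) ≠ 0 := fun h => hk (Fin.ext h)
    refine ⟨⟨k - 1, by omega⟩, ?_, ?_⟩
    · simp only [rho, if_true]
      intro h
      have := congrArg Fin.val h
      simp at this
      omega
    · funext j
      simp only [rho, if_true, V, Equiv.trans_apply]
      obtain ⟨i, hi⟩ : ∃ i, τ j = finRotate (e+1) i := ⟨(finRotate (e+1)).symm (τ j), by simp⟩
      rw [hi]
      rw [Equiv.symm_apply_apply]
      by_cases hl : i = Fin.last e
      · subst hl
        have hf : (finRotate (e+1)) (Fin.last e) = 0 := finRotate_last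
        rw [hf]
        rw [if_pos rfl, if_neg (by simp; omega), if_pos (by change 0 < (k:ℕ); omega)]
        simp
      · have h5 : ((finRotate (e+1)) i : ℕ) = i + 1 := coe_finRotate_of_ne_last hl
        have h6 : (finRotate (e+1)) i ≠ 0 := by
          intro h; rw [h] at h5; simp at h5
        rw [if_neg h6, h5]
        simp only [add_zero]
        congr 1
        apply if_congr _ rfl rfl
        omega
  · by_cases h1 : m = Fin.last _
    · subst h1
      have hk0 : (k : ℕ) ≠ e+1 := fun h => hk (Fin.ext h)
      refine ⟨⟨k + 1, by omega⟩, ?_, ?_⟩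
      · simp only [rho, if_true, if_neg h0]
        intro h
        have := congrArg Fin.val h
        simp at this
      · funext j
        simp only [rho, if_true, if_neg h0, V, Equiv.trans_apply]
        by_cases hl : τ j = Fin.last e
        · rw [hl, finRotate_last]
          simp
          omega
        · have h5 : ((finRotate (e+1)) (τ j) : ℕ) = τ j + 1 := coe_finRotate_of_ne_last hl
          rw [if_neg hl, h5]
          simp
    · refine ⟨k, by simpa [rho, h0, h1] using hk, ?_⟩
      funext j
      simp only [rho, if_neg h0, if_neg h1, V, Equiv.trans_apply]
      congr 1
      apply if_congr _ rfl rfl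
      have hm0 : (m : ℕ) ≠ 0 := fun h => h0 (Fin.ext h)
      have hm1 : (m : ℕ) ≠ e+1 := fun h => h1 (Fin.ext h)
      have hkm : (k : ℕ) ≠ m := fun h => hk (Fin.ext h)
      have := m.2
      have a1 : ((Fin.ofNat (e+1) (m - 1 : ℕ) : Fin (e+1)) : ℕ) = m - 1 :=
        Nat.mod_eq_of_lt (by omega)
      have a2 : ((Fin.ofNat (e+1) (m : ℕ) : Fin (e+1)) : ℕ) = m :=
        Nat.mod_eq_of_lt (by omega)
      rw [Equiv.swap_apply_def]
      split_ifs with c1 c2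
      · rw [c1]; omega
      · rw [c2]; omega
      · rfl

/-- door predicate -/
def Door {e : ℕ} (l : (Fin (e+1) → ℤ) → Fin (e+2)) (p : S e × Fin (e+2)) : Prop :=
  ∀ a, a ≠ 0 → ∃ k, k ≠ p.2 ∧ l (V p.1.1 p.1.2 k) = a

lemma door_rho {e : ℕ} (l : (Fin (e+1) → ℤ) → Fin (e+2)) (p : S e × Fin (e+2)) :
    Door l (rho p) ↔ Door l p := by
  have key : ∀ p, Door l p → Door l (rho p) := by
    intro p h a ha
    obtain ⟨k, hk, hka⟩ := h a ha
    obtain ⟨k', h1, h2⟩ := rho_facet p k hk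
    exact ⟨k', h1, by rw [h2, hka]⟩
  exact ⟨fun h => by simpa [rho_rho] using key _ h, key p⟩

open Classical in
lemma parity {e : ℕ} (l l' : (Fin (e+1) → ℤ) → Fin (e+2)) (P : Finset (S e))
    (hP : ∀ s, s ∉ P → ∀ k, l (V s.1 s.2 k) = l' (V s.1 s.2 k)) :
    ∑ s ∈ P, (if Function.Surjective (fun k => l (V s.1 s.2 k)) then (1 : ZMod 2) else 0)
    = ∑ s ∈ P, (if Function.Surjective (fun k => l' (V s.1 s.2 k)) then (1 : ZMod 2) else 0) := by
  have two : ∀ a : ZMod 2, a + a = 0 := by decide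
  have e2 : ∀ a b : ZMod 2, a + b = 0 → a = b := by decide
  apply e2
  simp only [← door_count]
  rw [← Finset.sum_add_distrib]
  simp only [← Finset.sum_add_distrib]
  rw [← Finset.sum_product']
  let g : S e × Fin (e+2) → ZMod 2 := fun p => (if Door l p then 1 else 0) + (if Door l' p then 1 else 0)
  have hsum : ∀ a b : ZMod 2, a = b → b = 0 → a = 0 := fun a b h1 h2 => h1.trans h2
  refine hsum _ (∑ p ∈ P ×ˢ Finset.univ, g p) (Finset.sum_congr rfl fun p _ => ?_) ?_
  · exact congrArg₂ (· + ·) (if_congr Iff.rfl rfl rfl) (if_congr Iff.rfl rfl rfl)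
  have hg : ∀ p, g (rho p) = g p := by
    intro p; simp only [g, door_rho]
  have hg0 : ∀ p : S e × Fin (e+2), p.1 ∉ P → g p = 0 := by
    intro p hp
    have : Door l p ↔ Door l' p := by simp only [Door, hP _ hp]
    simp only [g, this, two]
  rw [← Finset.sum_filter_ne_zero]
  refine Finset.sum_involution (fun p _ => rho p) ?_ ?_ ?_ ?_
  · intro p _
    rw [hg]; exact two _
  · intro p _ _; exact rho_ne p
  · intro p hp
    simp only [Finset.mem_filter, Finset.mem_product, Finset.mem_univ, and_true] at hp ⊢
    rw [hg]
    refine ⟨?_, hp.2⟩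
    by_contra h
    exact hp.2 (by rw [← hg, hg0 _ h])
  · intro p _; exact rho_rho p

lemma canon {d : ℕ} (N : ℤ) (hN : 0 < N) (y : Fin d → ℤ) :
    ∃ i : Fin (d+1), 0 < Y N y (i+1) ∧ ∀ j, j ≤ (i : ℕ) → Y N y j ≤ 0 := by
  have hex : ∃ i, 0 < Y N y (i+1) := ⟨d, by simpa [Y] using hN⟩
  classical
  have hle : Nat.find hex ≤ d := Nat.find_min' hex (by simpa [Y] using hN)
  refine ⟨⟨Nat.find hex, by omega⟩, Nat.find_spec hex, ?_⟩
  intro j hj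
  cases j with
  | zero => simp [Y]
  | succ j =>
    have := Nat.find_min hex (m := j) (by simpa using hj)
    omega

lemma canon_unique {e : ℕ} (N : ℤ) (hN : 0 < N) (l : (Fin (e+1) → ℤ) → Fin (e+2))
    (hl : ∀ y, 0 < Y N y (l y+1) ∧ ∀ j, j ≤ (l y : ℕ) → Y N y j ≤ 0) (s : S e) :
    Function.Surjective (fun k => l (V s.1 s.2 k)) ↔ s = (0, Fin.revPerm) := by
  obtain ⟨y, τ⟩ := s
  have Yj : ∀ (z : Fin (e+1) → ℤ) (j : Fin (e+1)), Y N z (j+1) = z j := by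
    intro z j; simp [Y, j.2]
  simp only
  constructor
  · intro h
    have hb : Function.Bijective (fun k => l (V y τ k)) :=
      ⟨Finite.injective_iff_surjective.2 h, h⟩
    have hanti : StrictAnti (fun k => l (V y τ k)) := by
      refine Antitone.strictAnti_of_injective ?_ hb.1
      intro k k' hkk
      simp only
      by_contra hlt
      push Not at hlt
      have h1 := (hl (V y τ k)).1
      have h2 := (hl (V y τ k')).2 (l (V y τ k) + 1) hlt
      obtain ⟨T, hT⟩ := Y_V N y τ
      have : (k:ℕ) ≤ k' := hkk
      rw [hT] at h1 h2
      split_ifs at * <;> omega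
    have hrev : ∀ k, l (V y τ k) = Fin.rev k := by
      have hm : StrictMono (fun k => l (V y τ (Fin.rev k))) := by
        intro a b hab
        exact hanti (Fin.rev_lt_rev.2 hab)
      have := hm.range_inj (g := id) strictMono_id |>.1 (by
        rw [Set.range_id]
        exact (h.comp Fin.rev_surjective).range_eq)
      intro k
      have := congrFun this (Fin.rev k)
      simpa using this
    have hV : ∀ k : Fin (e+2), ∀ j : Fin (e+1), 
        ((j:ℕ) + k = e + 1 → 0 < V y τ k j) ∧ ((j:ℕ) + k < e+1 → V y τ k j ≤ 0) := by
      intro k j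
      have h1 := (hl (V y τ k))
      rw [hrev] at h1
      have hk := Fin.val_rev k
      constructor
      · intro hj
        rw [← Yj (V y τ k) j]
        have : (j:ℕ) = (Fin.rev k : ℕ) := by omega
        rw [this]; exact h1.1
      · intro hj
        rw [← Yj (V y τ k) j]
        exact h1.2 _ (by omega)
    have hy : ∀ j, y j = 0 ∧ τ j = Fin.rev j := by
      intro j
      have hj := j.2
      have h1 := (hV 0 j).2 (by simp; omega)
      have h2 := (hV ⟨e+1 - j, by omega⟩ j).1 (by change (j:ℕ) + (e+1-j) = e+1; omega)
      have h3 := (hV ⟨e - j, by omega⟩ j).2 (by change (j:ℕ) + (e-j) < e+1; omega)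
      simp only [V] at h1 h2 h3
      have hr := Fin.val_rev j
      simp only [Fin.ext_iff, hr]
      simp at h1
      split_ifs at * <;> omega
    refine Prod.ext (funext fun j => (hy j).1) (Equiv.ext fun j => (hy j).2)
  · intro h
    obtain ⟨rfl, rfl⟩ := Prod.ext_iff.1 h
    intro a
    refine ⟨Fin.rev a, ?_⟩
    simp only
    have h1 := hl (V 0 Fin.revPerm (Fin.rev a))
    set b := l (V 0 Fin.revPerm (Fin.rev a)) with hb
    have ha := a.2
    have hb2 := b.2
    apply Fin.ext
    apply le_antisymm
    · by_contra hlt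
      push Not at hlt
      have h2 := h1.2 (a+1) hlt
      have h3 := Yj (V 0 Fin.revPerm (Fin.rev a)) ⟨a, by omega⟩
      simp only [] at h3
      rw [h3] at h2
      simp only [V, Fin.revPerm_apply, Fin.val_rev, Pi.zero_apply] at h2
      rw [if_pos (by omega)] at h2
      omega
    · by_contra hlt
      push Not at hlt
      have h2 := h1.1
      have h3 := Yj (V 0 Fin.revPerm (Fin.rev a)) ⟨b, by omega⟩
      simp only [] at h3
      rw [h3] at h2
      simp only [V, Fin.revPerm_apply, Fin.val_rev, Pi.zero_apply] at h2
      rw [if_neg (by omega)] at h2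
      omega

lemma inside_bdd {d : ℕ} (N : ℤ) (y : Fin d → ℤ) (h : ∀ i, 0 ≤ X N y i) :
    y ∈ Set.Icc (0 : Fin d → ℤ) (fun _ => N) := by
  have mono : ∀ i j, i ≤ j → j ≤ d+1 → Y N y i ≤ Y N y j := by
    intro i j hij
    induction j, hij using Nat.le_induction with
    | base => intro _; exact le_rfl
    | succ j hj ih =>
      intro hd
      have := h ⟨j, by omega⟩
      simp only [X] at this
      have := ih (by omega)
      omega
  constructor
  · intro j
    have := mono 0 (j+1) (by omega) (by omega)
    simpa [Y] using this
  · intro j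
    have := mono (j+1) (d+1) (by omega) (by omega)
    simpa [Y] using this

lemma sperner {e : ℕ} (N : ℤ) (hN : 0 < N) (l : (Fin (e+1) → ℤ) → Fin (e+2))
    (hl : ∀ y, (∀ i, 0 ≤ X N y i) → 0 < X N y (l y)) :
    ∃ y τ, (∀ k i, 0 ≤ X N (V y τ k) i) ∧ Function.Surjective (fun k => l (V y τ k)) := by
  classical
  choose l0 hl0 using fun y : Fin (e+1) → ℤ => canon N hN y
  let l1 : (Fin (e+1) → ℤ) → Fin (e+2) := fun y => if ∀ i, 0 ≤ X N y i then l y else l0 y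
  have hl1 : ∀ y, 0 < X N y (l1 y) := by
    intro y
    simp only [l1]
    split_ifs with h
    · exact hl y h
    · have h1 := (hl0 y).1
      have h2 := (hl0 y).2 _ le_rfl
      simp only [X]; omega
  -- finite set of simplices touching the inside
  have hfin : {s : S e | ∃ k, V s.1 s.2 k ∈ Set.Icc (0 : Fin (e+1) → ℤ) (fun _ => N)}.Finite := by
    have hK : (Set.Icc (0 : Fin (e+1) → ℤ) (fun _ => N)).Finite := Set.finite_Icc _ _
    have := (hK.prod (Set.finite_univ (α := Equiv.Perm (Fin (e+1)) × Fin (e+2)))).image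
      (fun q => ((fun j => q.1 j - if (q.2.1 j : ℕ) < (q.2.2 : ℕ) then 1 else 0, q.2.1) : S e))
    refine this.subset ?_
    rintro ⟨y, τ⟩ ⟨k, hk⟩
    refine ⟨(V y τ k, τ, k), ⟨hk, Set.mem_univ _⟩, ?_⟩
    simp [V]
  have hpar := parity l1 l0 hfin.toFinset (by
    intro s hs k
    simp only [Set.Finite.mem_toFinset, Set.mem_ofPred_eq, not_exists] at hs
    simp only [l1]
    rw [if_neg]
    intro h
    exact hs k (inside_bdd N _ h))
  have h0 : ∑ s ∈ hfin.toFinset,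
      (if Function.Surjective (fun k => l0 (V s.1 s.2 k)) then (1 : ZMod 2) else 0) = 1 := by
    simp only [canon_unique N hN l0 hl0]
    rw [Finset.sum_ite_eq' hfin.toFinset, if_pos]
    simp only [Set.Finite.mem_toFinset, Set.mem_ofPred_eq]
    refine ⟨0, ?_⟩
    have : V (0 : Fin (e+1) → ℤ) Fin.revPerm 0 = 0 := by
      funext j; simp [V]
    rw [this]
    exact ⟨le_rfl, fun _ => hN.le⟩
  rw [h0] at hpar
  obtain ⟨s, -, hs⟩ := Finset.exists_ne_zero_of_sum_ne_zero (by rw [hpar]; decide)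
  have hs' : Function.Surjective (fun k => l1 (V s.1 s.2 k)) := by
    by_contra h
    exact hs (if_neg h)
  have hin : ∀ k i, 0 ≤ X N (V s.1 s.2 k) i := by
    intro k i
    obtain ⟨m, hm⟩ := hs' i
    apply X_sign N s.1 s.2 k m i
    have := hl1 (V s.1 s.2 m)
    simp only at hm
    rwa [hm] at this
  refine ⟨s.1, s.2, hin, ?_⟩
  have : (fun k => l1 (V s.1 s.2 k)) = fun k => l (V s.1 s.2 k) := by
    funext k
    simp only [l1]
    rw [if_pos (hin k)]
  rwa [this] at hs'

lemma sum_V {d : ℕ} (y : Fin d → ℤ) (τ : Equiv.Perm (Fin d)) (k : Fin (d+1)) :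
    ∑ j, V y τ k j = ∑ j, y j + k := by
  simp only [V, Finset.sum_add_distrib]
  congr 1
  rw [Equiv.sum_comp τ (fun j => if (j : ℕ) < (k : ℕ) then (1 : ℤ) else 0)]
  rw [Fin.sum_univ_eq_sum_range (fun j => if j < (k : ℕ) then (1 : ℤ) else 0) d]
  rw [← Finset.sum_filter]
  have : (Finset.range d).filter (fun j => j < (k : ℕ)) = Finset.range k := by
    ext j; simp; omega
  rw [this]; simp

lemma approx {e : ℕ} (A : Fin (e+2) → Fin (e+2) → Set (Fin (e+2) → ℝ))
    (hKKM : ∀ j, IsKKMCover (A j)) (N : ℕ) :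
    ∃ (π : Equiv.Perm (Fin (e+2))) (p : Fin (e+2) → Fin (e+2) → ℝ),
      (∀ i, p i ∈ stdSimplex ℝ (Fin (e+2))) ∧ (∀ i, p i ∈ A (π i) i) ∧
      ∀ i j, dist (p i) (p j) ≤ 1 / ((N : ℝ) + 1) := by
  classical
  have hN : (0 : ℤ) < (N : ℤ) + 1 := by omega
  have hNr : (0 : ℝ) < (N : ℝ) + 1 := by positivity
  let M : ℤ := (N : ℤ) + 1
  let pt : (Fin (e+1) → ℤ) → Fin (e+2) → ℝ := fun y i => (X M y i : ℝ) / ((N : ℝ) + 1)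
  let ow : (Fin (e+1) → ℤ) → Fin (e+2) := fun y => ((∑ j, y j : ℤ) : ZMod (e+2))
  have hpt : ∀ y, (∀ i, 0 ≤ X M y i) → pt y ∈ stdSimplex ℝ (Fin (e+2)) := by
    intro y hy
    refine ⟨fun i => div_nonneg (by exact_mod_cast hy i) hNr.le, ?_⟩
    simp only [pt]
    rw [← Finset.sum_div, ← Int.cast_sum, X_sum]
    simp only [M]; push_cast
    exact div_self hNr.ne'
  have hlab : ∀ y, ∃ i, (∀ i, 0 ≤ X M y i) → 0 < X M y i ∧ pt y ∈ A (ow y) i := by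
    intro y
    by_cases hy : ∀ i, 0 ≤ X M y i
    · have hne : (Finset.univ.filter (fun i => 0 < X M y i)).Nonempty := by
        by_contra h
        rw [Finset.not_nonempty_iff_eq_empty, Finset.filter_eq_empty_iff] at h
        have h1 := X_sum M y
        have h2 : ∑ i, X M y i ≤ 0 := Finset.sum_nonpos (fun i hi => not_lt.1 (h hi))
        simp only [M] at *
        omega
      obtain ⟨i, hi, hiA⟩ := hKKM (ow y) _ hne (pt y) (hpt y hy) (by
        intro j hj
        simp only [Finset.mem_filter, Finset.mem_univ, true_and, not_lt] at hj
        have : X M y j = 0 := le_antisymm hj (hy j)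
        simp [pt, this])
      exact ⟨i, fun _ => ⟨by simpa using hi, hiA⟩⟩
    · exact ⟨0, fun h => absurd h hy⟩
  choose l hl using hlab
  obtain ⟨y, τ, hin, hsurj⟩ := sperner M hN l (fun y hy => (hl y hy).1)
  have hbij : Function.Bijective (fun k => l (V y τ k)) :=
    ⟨Finite.injective_iff_surjective.2 hsurj, hsurj⟩
  have hown : Function.Bijective (fun k => ow (V y τ k)) := by
    rw [← Finite.injective_iff_bijective]
    intro k k' h
    simp only [ow, sum_V] at h
    have h' : (((∑ j, y j) + (k:ℕ) : ℤ) : ZMod (e+2)) = (((∑ j, y j) + (k':ℕ) : ℤ) : ZMod (e+2)) := h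
    push_cast at h'
    have h2 := add_left_cancel h'
    rw [ZMod.natCast_eq_natCast_iff', Nat.mod_eq_of_lt k.2, Nat.mod_eq_of_lt k'.2] at h2
    exact Fin.ext h2
  let L := Equiv.ofBijective _ hbij
  let O := Equiv.ofBijective _ hown
  have hL : ∀ i, l (V y τ (L.symm i)) = i := fun i => L.apply_symm_apply i
  refine ⟨L.symm.trans O, fun i => pt (V y τ (L.symm i)), fun i => hpt _ (hin _), ?_, ?_⟩
  · intro i
    have := (hl _ (hin (L.symm i))).2
    rw [hL] at this
    exact this
  · intro i j
    rw [dist_pi_le_iff (by positivity)]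
    intro a
    have := X_close M y τ (L.symm j) (L.symm i) a
    simp only [pt]
    rw [Real.dist_eq, ← sub_div, abs_div, abs_of_pos hNr]
    gcongr
    exact_mod_cast this

end KKMaux

/-- Gale's colorful KKM theorem. -/
theorem colorful_kkm (n : ℕ) (hn : 1 ≤ n)
    (A : Fin n → Fin n → Set (Fin n → ℝ))
    (hclosed : ∀ i j, IsClosed (A i j))
    (hsub : ∀ i j, A i j ⊆ stdSimplex ℝ (Fin n))
    (hKKM : ∀ j : Fin n, IsKKMCover (A j)) :
    ∃ π : Equiv.Perm (Fin n), (⋂ i, A (π i) i).Nonempty := by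
  obtain _ | _ | e := n
  · omega
  · refine ⟨1, fun _ => 1, ?_⟩
    obtain ⟨j, -, hj⟩ := hKKM 0 Finset.univ Finset.univ_nonempty (fun _ => 1)
      ⟨fun _ => zero_le_one, by simp⟩ (by simp)
    rw [Set.mem_iInter]
    intro i
    have h1 : i = j := Fin.ext (by omega)
    have h2 : (1 : Equiv.Perm (Fin (0+1))) j = 0 := Fin.ext (by omega)
    rw [h1, h2]
    exact hj
  · choose π p hp hA hd using KKMaux.approx A hKKM
    obtain ⟨x, -, φ, hφ, hx⟩ := (isCompact_stdSimplex ℝ (Fin (e+2))).tendsto_subseq (fun N => hp N 0)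
    have hx' : ∀ i, Filter.Tendsto (fun N => p (φ N) i) Filter.atTop (nhds x) := by
      intro i
      refine hx.congr_dist ?_
      refine squeeze_zero (fun _ => dist_nonneg) (fun N => hd (φ N) 0 i) ?_
      exact tendsto_one_div_add_atTop_nhds_zero_nat.comp hφ.tendsto_atTop
    have hfreq : ∃ σ, ∃ᶠ N in Filter.atTop, π (φ N) = σ := by
      by_contra h
      push Not at h
      have := Filter.eventually_all.2 h
      obtain ⟨N, hN⟩ := this.exists
      exact hN _ rfl
    obtain ⟨σ, hσ⟩ := hfreq
    refine ⟨σ, x, Set.mem_iInter.2 fun i => ?_⟩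
    refine (hclosed _ _).mem_of_frequently_of_tendsto (hσ.mono ?_) (hx' i)
    intro N hN
    rw [← hN]
    exact hA _ i
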